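/- With the basic setup (n ≥ 3, 2n groups G_i with n-split epimorphisms φ_i : G_i → L = A_1 × ⋯ × A_n, and Φ : G_1 × ⋯ × G_{2n} → L given by Φ(g) = Σ_{i=1}^{2n} φ_i(pr^G_i(g))), assume in addition that every G_i (1 ≤ i ≤ 2n) is finitely presented. Then Ker(Φ) is a finitely presented group: there exist k ∈ ℕ, a finite subset R of the free group F on k generators, and a surjective group homomorphism π : F → Ker(Φ) whose kernel equals the normal closure of R in F. -/

import Mathlib

namespace SB

/-- Ceiling indices: `cc n p` is the 0-based start of the `p`-th label sequence. -/
def cc (n p : ℕ) : ℕ := if p < 3 then (p * n + 2) / 3 else n + ((p - 3) * n + 2) / 3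

open Subgroup
open scoped commutatorElement

theorem exists_finite_subset_image_eq {α β : Type*} {f : α → β} {s : Set β} {u : Set α}
    (hs : s.Finite) (h : s ⊆ f '' u) : ∃ t ⊆ u, t.Finite ∧ f '' t = s := by
  obtain ⟨v, hvu, rfl⟩ := Set.subset_image_iff.1 h
  obtain ⟨t, htv, ht⟩ := Set.exists_subset_bijOn v f
  exact ⟨t, htv.trans hvu, Set.Finite.of_finite_image (ht.image_eq ▸ hs) ht.injOn, ht.image_eq⟩

section Finiteness

variable {G H K : Type} [Group G] [Group H] [Group K]

/-- A finitely presented group is finitely generated. -/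
theorem fg_of_isFinitelyPresented [h : Group.IsFinitelyPresented G] : Group.FG G := by
  obtain ⟨n, φ, hφ, -⟩ := h
  exact Group.fg_of_surjective hφ

/-- The kernel of an epimorphism from a finitely generated group onto a finitely presented group
is finitely normally generated. -/
theorem ker_isFinitelyNormallyGenerated [Group.FG G] [h : Group.IsFinitelyPresented H]
    {f : G →* H} (hf : Function.Surjective f) : f.ker.IsFinitelyNormallyGenerated := by
  obtain ⟨n, φ, hφ, R, hR, hRφ⟩ := h
  choose g hg using hf
  let ψ : FreeGroup (Fin n) →* G := FreeGroup.lift fun i => g (φ (.of i))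
  have hψ : ∀ w, f (ψ w) = φ w := fun w => by
    have : f.comp ψ = φ := FreeGroup.ext_hom _ _ fun i => by simp [ψ, hg]
    exact DFunLike.congr_fun this w
  obtain ⟨X, hX, hXfin⟩ := Group.fg_iff.1 ‹Group.FG G›
  choose w hw using hφ
  let S : Set G := ψ '' R ∪ (fun x => (ψ (w (f x)))⁻¹ * x) '' X
  refine ⟨S, (hR.image _).union (hXfin.image _), le_antisymm (normalClosure_le_normal ?_) ?_⟩
  · rintro _ (⟨r, hr, rfl⟩ | ⟨x, -, rfl⟩)
    · have : r ∈ φ.ker := hRφ ▸ subset_normalClosure hr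
      simpa [MonoidHom.mem_ker, hψ] using this
    · simp [MonoidHom.mem_ker, hψ, hw]
  · have hker : φ.ker ≤ (normalClosure S).comap ψ := by
      rw [← hRφ]
      exact normalClosure_le_normal fun r hr => subset_normalClosure (Or.inl ⟨r, hr, rfl⟩)
    have htop : ψ.range ⊔ normalClosure S = ⊤ := by
      rw [eq_top_iff, ← hX, closure_le]
      intro x hx
      exact mem_sup_of_normal_right.2 ⟨_, ⟨w (f x), rfl⟩, _,
        subset_normalClosure (Or.inr ⟨x, hx, rfl⟩), by simp⟩
    intro x hx
    obtain ⟨_, ⟨v, rfl⟩, m, hm, rfl⟩ := mem_sup_of_normal_right.1 (htop ▸ mem_top x)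
    have hm' : f m = 1 := by
      refine (normalClosure_le_normal (N := f.ker) ?_) hm
      rintro _ (⟨r, hr, rfl⟩ | ⟨x, -, rfl⟩)
      · have : r ∈ φ.ker := hRφ ▸ subset_normalClosure hr
        simpa [MonoidHom.mem_ker, hψ] using this
      · simp [MonoidHom.mem_ker, hψ, hw]
    exact mul_mem (hker (by simpa [MonoidHom.mem_ker, hm', hψ] using hx)) hm

/-- A normal subgroup with abelian quotient in a finitely generated group is finitely normally
generated. -/
theorem isFinitelyNormallyGenerated_of_commutator_le [Group.FG G] {M : Subgroup G}
    (hM : commutator G ≤ M) : M.IsFinitelyNormallyGenerated := by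
  obtain ⟨X, hX, hXfin⟩ := Group.fg_iff.1 ‹Group.FG G›
  let S : Set G := Set.image2 (fun x y => ⁅x, y⁆) X X
  have hS : (Abelianization.of (G := G)).ker.IsFinitelyNormallyGenerated := by
    refine ⟨S, hXfin.image2 _ hXfin, le_antisymm (normalClosure_le_normal ?_) ?_⟩
    · rintro _ ⟨x, -, y, -, rfl⟩
      rw [Abelianization.ker_of, _root_.commutator_def]
      exact commutator_mem_commutator (mem_top _) (mem_top _)
    · let μ := QuotientGroup.mk' (normalClosure S)
      have hcomm : (⊤ : Subgroup G).map μ ≤ centralizer ((⊤ : Subgroup G).map μ) := by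
        rw [← hX, MonoidHom.map_closure, centralizer_closure, closure_le]
        rintro _ ⟨x, hx, rfl⟩
        rw [SetLike.mem_coe, mem_centralizer_iff]
        rintro _ ⟨y, hy, rfl⟩
        refine (commutatorElement_eq_one_iff_commute.1 ?_ : Commute _ _).symm.eq
        rw [← map_commutatorElement]
        exact (QuotientGroup.eq_one_iff _).2 (subset_normalClosure ⟨x, hx, y, hy, rfl⟩)
      rw [Abelianization.ker_of, _root_.commutator_def, commutator_le]
      intro g _ h _
      rw [← QuotientGroup.eq_one_iff]
      change μ ⁅g, h⁆ = 1
      rw [map_commutatorElement, commutatorElement_eq_one_iff_commute]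
      exact (mem_centralizer_iff.1 (hcomm ⟨g, mem_top _, rfl⟩) _ ⟨h, mem_top _, rfl⟩).symm
  have hsurj : Function.Surjective (Abelianization.of (G := G)) := QuotientGroup.mk'_surjective _
  have : Group.FG (Abelianization G) := Group.fg_of_surjective hsurj
  have : Module.Finite ℤ (Additive (Abelianization G)) :=
    Module.Finite.iff_addGroup_fg.2 inferInstance
  have hfg : (M.map Abelianization.of).FG := by
    rw [Subgroup.fg_iff_add_fg]
    let N : AddSubgroup (Additive (Abelianization G)) :=
      toAddSubgroup (M.map Abelianization.of)
    exact (Submodule.fg_iff_addSubgroup_fg (AddSubgroup.toIntSubmodule N)).1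
      (IsNoetherian.noetherian _)
  have : Group.FG (M.map Abelianization.of) := (Group.fg_iff_subgroup_fg _).2 hfg
  have := (IsFinitelyNormallyGenerated.of_FG (M.map Abelianization.of)).comap hsurj hS
  rwa [comap_map_eq_self (by rwa [Abelianization.ker_of])] at this

theorem commute_of_inf_eq_bot {A B : Subgroup K} [A.Normal] [B.Normal] (h : A ⊓ B = ⊥)
    {a b : K} (ha : a ∈ A) (hb : b ∈ B) : Commute a b :=
  Subgroup.commute_of_normal_of_disjoint A B ‹_› ‹_› (disjoint_iff.2 h) a b ha hb

/-- A group with two normal subgroups that intersect trivially, both with finitely generated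
quotient, and whose product has abelian quotient, is finitely generated. -/
theorem fg_of_subdirect {p : K →* G} {q : K →* H} (hp : Function.Surjective p)
    (hq : Function.Surjective q) [Group.FG G] [Group.FG H] (hbot : p.ker ⊓ q.ker = ⊥)
    (hab : commutator K ≤ p.ker ⊔ q.ker) : Group.FG K := by
  have hmap : commutator G ≤ q.ker.map p := by
    rw [commutator_def, ← MonoidHom.range_eq_top.2 hp, MonoidHom.range_eq_map,
      ← map_commutator, ← commutator_def]
    refine (map_mono hab).trans ?_
    rw [Subgroup.map_sup, sup_le_iff, map_le_iff_le_comap]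
    exact ⟨fun x hx => by simp [MonoidHom.mem_ker.1 hx, one_mem], le_rfl⟩
  obtain ⟨S, hS, hSq⟩ := isFinitelyNormallyGenerated_of_commutator_le hmap
  obtain ⟨T, hTq, hT, rfl⟩ := exists_finite_subset_image_eq (f := p) (u := q.ker) hS
    (by rw [← coe_map, ← hSq]; exact subset_normalClosure)
  obtain ⟨X, hX, hXfin⟩ := Group.fg_iff.1 ‹Group.FG G›
  obtain ⟨Y, hY, hYfin⟩ := Group.fg_iff.1 ‹Group.FG H›
  choose x hx using hp
  choose y hy using hq
  let C : Subgroup K := closure (T ∪ x '' X ∪ y '' Y)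
  have hCG : C.map p = ⊤ := by
    rw [eq_top_iff, ← hX, closure_le]
    exact fun g hg => ⟨x g, subset_closure (Or.inl (Or.inr ⟨g, hg, rfl⟩)), hx g⟩
  have hCH : C.map q = ⊤ := by
    rw [eq_top_iff, ← hY, closure_le]
    exact fun g hg => ⟨y g, subset_closure (Or.inr ⟨g, hg, rfl⟩), hy g⟩
  have hqC : q.ker ≤ C := by
    have hn : (C ⊓ q.ker).Normal := by
      refine ⟨fun b hb k => ?_⟩
      obtain ⟨c, hc, hck⟩ : p k ∈ C.map p := hCG ▸ mem_top _
      have hk : c⁻¹ * k ∈ p.ker := by simp [MonoidHom.mem_ker, hck]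
      have hcomm := commute_of_inf_eq_bot hbot hk hb.2
      have : k * b * k⁻¹ = c * b * c⁻¹ := by
        have h2 : (c⁻¹ * k) * b * (c⁻¹ * k)⁻¹ = b := by rw [hcomm.eq, mul_inv_cancel_right]
        calc _ = c * ((c⁻¹ * k) * b * (c⁻¹ * k)⁻¹) * c⁻¹ := by group
          _ = _ := by rw [h2]
      rw [this]
      exact ⟨C.mul_mem (C.mul_mem hc hb.1) (C.inv_mem hc),
        (inferInstance : q.ker.Normal).conj_mem _ hb.2 _⟩
    have hle : normalClosure T ≤ C ⊓ q.ker :=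
      normalClosure_le_normal fun t ht => ⟨subset_closure (Or.inl (Or.inl ht)), hTq ht⟩
    intro b hb
    rw [← map_normalClosure T p fun g => ⟨x g, hx g⟩] at hSq
    obtain ⟨t, ht, hpt⟩ : p b ∈ (normalClosure T).map p := hSq ▸ ⟨b, hb, rfl⟩
    have : t⁻¹ * b ∈ p.ker ⊓ q.ker :=
      ⟨by simp [hpt], q.ker.mul_mem (q.ker.inv_mem (hle ht).2) hb⟩
    rw [hbot, mem_bot, inv_mul_eq_one] at this
    exact this ▸ (hle ht).1
  refine Group.fg_iff.2 ⟨_, ?_, ((hT.union (hXfin.image x)).union (hYfin.image y))⟩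
  change C = ⊤
  rw [eq_top_iff]
  intro k _
  obtain ⟨c, hc, hck⟩ : q k ∈ C.map q := hCH ▸ mem_top _
  have : c⁻¹ * k ∈ C := hqC (by simp [MonoidHom.mem_ker, hck])
  simpa using mul_mem hc this

/-- The product of two finitely presented groups is finitely presented. -/
theorem isFinitelyPresented_prod [hG : Group.IsFinitelyPresented G]
    [hH : Group.IsFinitelyPresented H] : Group.IsFinitelyPresented (G × H) := by
  obtain ⟨X, hX, hXfin⟩ := Group.fg_iff.1 (fg_of_isFinitelyPresented (G := G))
  obtain ⟨Y, hY, hYfin⟩ := Group.fg_iff.1 (fg_of_isFinitelyPresented (G := H))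
  let S : Set (Monoid.Coprod G H) :=
    Set.image2 (fun (x : G) (y : H) =>
      ⁅(Monoid.Coprod.inl x : Monoid.Coprod G H), Monoid.Coprod.inr y⁆) X Y
  refine .of_surjective Monoid.Coprod.toProd Monoid.Coprod.toProd_surjective
    ⟨S, hXfin.image2 _ hYfin, le_antisymm (normalClosure_le_normal ?_) ?_⟩
  · rintro _ ⟨x, -, y, -, rfl⟩
    simp [MonoidHom.mem_ker, commutatorElement_def]
  · let μ := QuotientGroup.mk' (normalClosure S)
    have hcomm : ∀ g h, Commute (μ.comp Monoid.Coprod.inl g) (μ.comp Monoid.Coprod.inr h) := by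
      have h1 : (⊤ : Subgroup G).map (μ.comp Monoid.Coprod.inl) ≤
          centralizer ((⊤ : Subgroup H).map (μ.comp Monoid.Coprod.inr)) := by
        rw [← hX, ← hY, MonoidHom.map_closure, MonoidHom.map_closure, centralizer_closure,
          closure_le]
        rintro _ ⟨x, hx, rfl⟩
        rw [SetLike.mem_coe, mem_centralizer_iff]
        rintro _ ⟨y, hy, rfl⟩
        refine (commutatorElement_eq_one_iff_commute.1 ?_ : Commute _ _).symm.eq
        simp only [MonoidHom.comp_apply, ← map_commutatorElement]
        exact (QuotientGroup.eq_one_iff _).2 (subset_normalClosure ⟨x, hx, y, hy, rfl⟩)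
      intro g h
      exact (mem_centralizer_iff.1 (h1 ⟨g, mem_top _, rfl⟩) _ ⟨h, mem_top _, rfl⟩).symm
    have hfac : (MonoidHom.noncommCoprod _ _ hcomm).comp Monoid.Coprod.toProd = μ :=
      Monoid.Coprod.hom_ext (by ext; simp) (by ext; simp)
    intro w hw
    rw [← QuotientGroup.ker_mk' (normalClosure S)]
    change μ w = 1
    rw [← hfac, MonoidHom.comp_apply, MonoidHom.mem_ker.1 hw, map_one]

end Finiteness

/-- A finite product of finitely presented groups is finitely presented. -/
theorem isFinitelyPresented_pi (ι : Type) [Finite ι] : ∀ (G : ι → Type) [∀ i, Group (G i)]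
    [∀ i, Group.IsFinitelyPresented (G i)], Group.IsFinitelyPresented (∀ i, G i) := by
  induction ι using Finite.induction_empty_option with
  | of_equiv e ih =>
    intro G _ _
    have := ih (fun a => G (e a))
    exact .equiv (MulEquiv.mk (Equiv.piCongrLeft G e) fun f g => by
      funext b
      obtain ⟨a, rfl⟩ := e.surjective b
      simp)
  | h_empty => intro G _ _; infer_instance
  | h_option ih =>
    intro G _ _
    have := ih (fun a => G (some a))
    have := isFinitelyPresented_prod (G := G none) (H := ∀ a, G (some a))
    exact .equiv (MulEquiv.mk Equiv.piOptionEquivProd fun _ _ => rfl).symm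

section Presentations

variable {G H K : Type} [Group G] [Group H] [Group K]

/-- An additive subgroup of a module over an integral group ring that is stable under the group,
as a submodule. -/
def stableSubmodule {Q M : Type} [CommGroup Q] [AddCommGroup M]
    [Module (MonoidAlgebra ℤ Q) M] (V : AddSubgroup M)
    (hV : ∀ q : Q, ∀ v ∈ V, MonoidAlgebra.of ℤ Q q • v ∈ V) : Submodule (MonoidAlgebra ℤ Q) M where
  __ := V
  smul_mem' r v hv := by
    induction r using MonoidAlgebra.induction_on with
    | of q => exact hV q v hv
    | add x y hx hy => rw [add_smul]; exact V.add_mem hx hy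
    | smul n x hx => rw [smul_assoc]; exact V.zsmul_mem hx n

/-- Let `T` be an abelian normal subgroup of a finitely generated group `G`, centralized by the
commutator subgroup of `G`. If `T` is finitely normally generated, then so is every normal subgroup
of `G` contained in `T`. -/
theorem isFinitelyNormallyGenerated_of_le [Group.FG G] {T U : Subgroup G} [T.Normal] [U.Normal]
    (hcomm : ∀ s ∈ T, ∀ t ∈ T, Commute s t) (hcent : ∀ c ∈ commutator G, ∀ t ∈ T, Commute c t)
    (hT : T.IsFinitelyNormallyGenerated) (hU : U ≤ T) : U.IsFinitelyNormallyGenerated := by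
  let _ : CommGroup T :=
    { (inferInstance : Group T) with mul_comm := fun a b => Subtype.ext (hcomm _ a.2 _ b.2) }
  let ρ₀ : G →* AddMonoid.End (Additive T) :=
    { toFun := fun g => MonoidHom.toAdditive (MulAut.conjNormal g : MulAut T).toMonoidHom
      map_one' := by rw [map_one]; rfl
      map_mul' := fun g h => by rw [map_mul]; rfl }
  let ρ : Abelianization G →* AddMonoid.End (Additive T) :=
    QuotientGroup.lift (commutator G) ρ₀ fun c hc => by
      refine AddMonoidHom.ext fun t => congrArg Additive.ofMul (Subtype.ext ?_)
      change c * ((Additive.toMul t : T) : G) * c⁻¹ = _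
      rw [(hcent c hc _ (Additive.toMul t).2).eq, mul_inv_cancel_right]
      rfl
  let _ : Module (MonoidAlgebra ℤ (Abelianization G)) (Additive T) :=
    Module.compHom _ (MonoidAlgebra.liftNCRingHom (Int.castRingHom _) ρ
      fun n q => Int.cast_commute n _)
  have hsmul : ∀ (g : G) (t : T), MonoidAlgebra.of ℤ (Abelianization G) (Abelianization.of g) •
      Additive.ofMul t = Additive.ofMul (MulAut.conjNormal g t) := by
    intro g t
    change (MonoidAlgebra.liftNCRingHom (Int.castRingHom _) ρ fun n q => Int.cast_commute n _)
      (MonoidAlgebra.of ℤ (Abelianization G) (Abelianization.of g)) (Additive.ofMul t) = _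
    have : (MonoidAlgebra.liftNCRingHom (Int.castRingHom _) ρ fun n q => Int.cast_commute n _)
        (MonoidAlgebra.of ℤ (Abelianization G) (Abelianization.of g)) = ρ₀ g := by
      rw [MonoidAlgebra.of_apply]
      refine (MonoidAlgebra.liftNC_single _ _ _ _).trans ?_
      simp [ρ]
      rfl
    rw [this]
    rfl
  have : Group.FG (Abelianization G) := QuotientGroup.fg _
  have : IsNoetherianRing (MonoidAlgebra ℤ (Abelianization G)) :=
    Algebra.FiniteType.isNoetherianRing ℤ _
  obtain ⟨S, hS, hST⟩ := hT
  have hfin : Module.Finite (MonoidAlgebra ℤ (Abelianization G)) (Additive T) := by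
    let S' : Set (Additive T) := {t | ((Additive.toMul t : T) : G) ∈ S}
    have hS' : S'.Finite :=
      hS.preimage ((Subtype.val_injective.comp Additive.toMul.injective).injOn)
    let P := Submodule.span (MonoidAlgebra ℤ (Abelianization G)) S'
    have hn : ((AddSubgroup.toSubgroup' P.toAddSubgroup).map T.subtype).Normal := by
      refine ⟨?_⟩
      rintro _ ⟨t, ht, rfl⟩ g
      refine ⟨MulAut.conjNormal g t, ?_, rfl⟩
      have := P.smul_mem (MonoidAlgebra.of ℤ (Abelianization G) (Abelianization.of g)) ht
      exact hsmul g t ▸ this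
    have hle : T ≤ (AddSubgroup.toSubgroup' P.toAddSubgroup).map T.subtype := by
      conv_lhs => rw [← hST]
      refine normalClosure_le_normal fun s hs => ?_
      have hsT : s ∈ T := hST ▸ subset_normalClosure hs
      have hsP : Additive.ofMul (⟨s, hsT⟩ : T) ∈ P := Submodule.subset_span (show s ∈ S from hs)
      exact ⟨⟨s, hsT⟩, hsP, rfl⟩
    refine ⟨Submodule.fg_def.2 ⟨S', hS', eq_top_iff.2 fun t _ => ?_⟩⟩
    obtain ⟨t', ht', h⟩ := hle (Additive.toMul t).2
    obtain rfl : t' = Additive.toMul t := Subtype.ext h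
    exact ht'
  have := isNoetherian_of_isNoetherianRing_of_finite
    (MonoidAlgebra ℤ (Abelianization G)) (Additive T)
  have hstable : ∀ N : Subgroup G, N.Normal →
      ∃ P : Submodule (MonoidAlgebra ℤ (Abelianization G)) (Additive T),
        ∀ t : T, Additive.ofMul t ∈ P ↔ (t : G) ∈ N := fun N hN =>
    ⟨stableSubmodule (toAddSubgroup (N.subgroupOf T)) fun q v hv => by
      obtain ⟨g, rfl⟩ := QuotientGroup.mk'_surjective _ q
      have := hsmul g (Additive.toMul v)
      exact this ▸ hN.conj_mem _ hv g, fun t => Iff.rfl⟩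
  obtain ⟨P, hP⟩ := hstable U inferInstance
  obtain ⟨Y, hY, hYP⟩ := Submodule.fg_def.1 (IsNoetherian.noetherian P)
  let val : Additive T → G := fun t => ((Additive.toMul t : T) : G)
  refine ⟨val '' Y, hY.image val, le_antisymm (normalClosure_le_normal ?_) fun u hu => ?_⟩
  · rintro _ ⟨y, hy, rfl⟩
    exact (hP (Additive.toMul y)).1 (hYP ▸ Submodule.subset_span hy)
  · obtain ⟨P', hP'⟩ := hstable (normalClosure (val '' Y)) inferInstance
    have hle : P ≤ P' := by
      rw [← hYP, Submodule.span_le]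
      exact fun y hy => (hP' (Additive.toMul y)).2 (subset_normalClosure ⟨y, hy, rfl⟩)
    exact (hP' ⟨u, hU hu⟩).1 (hle ((hP ⟨u, hU hu⟩).2 hu))

/-- A homomorphism onto a free group has a section. -/
theorem exists_section_of_isFreeGroup [IsFreeGroup H] {f : G →* H} (hf : Function.Surjective f) :
    ∃ σ : H →* G, ∀ h, f (σ h) = h := by
  choose g hg using hf
  refine ⟨IsFreeGroup.lift fun i => g (IsFreeGroup.of i), fun h => ?_⟩
  have : f.comp (IsFreeGroup.lift fun i => g (IsFreeGroup.of i)) = MonoidHom.id H :=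
    IsFreeGroup.ext_hom fun i => by simp [hg]
  exact DFunLike.congr_fun this h

theorem commutatorElement_mul_mul_of_commute {a b x y : G} (hay : Commute a y) (hbx : Commute b x)
    (hxy : Commute x y) :
    ⁅a * x, b * y⁆ = ⁅a, b⁆ := by
  have h1 : Commute y (a * x) := (hay.mul_left hxy).symm
  have h2 : Commute x b := hbx.symm
  rw [commutatorElement_def, commutatorElement_def, mul_inv_rev b y]
  calc a * x * (b * y) * (a * x)⁻¹ * (y⁻¹ * b⁻¹)
      = a * x * b * (y * (a * x)⁻¹) * y⁻¹ * b⁻¹ := by group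
    _ = a * (x * b) * x⁻¹ * a⁻¹ * b⁻¹ := by rw [h1.inv_right.eq]; group
    _ = a * b * a⁻¹ * b⁻¹ := by rw [h2.eq]; group

/-- The intersection of two commuting normal subgroups with finitely presented quotients whose
product has abelian quotient is finitely normally generated. -/
theorem inf_isFinitelyNormallyGenerated [Group.FG K] [Group.IsFinitelyPresented G]
    [Group.IsFinitelyPresented H] {p : K →* G} {q : K →* H} (hp : Function.Surjective p)
    (hq : Function.Surjective q) (hcomm : ∀ a ∈ p.ker, ∀ b ∈ q.ker, Commute a b)
    (hab : commutator K ≤ p.ker ⊔ q.ker) : (p.ker ⊓ q.ker).IsFinitelyNormallyGenerated := by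
  obtain ⟨ι, _, μ, hμ⟩ := Group.fg_iff_exists_freeGroup_hom_surjective_finite.1 ‹Group.FG K›
  obtain ⟨S, hSfin, hS⟩ := ker_isFinitelyNormallyGenerated (f := q.comp μ) (hq.comp hμ)
  have : Finite S := hSfin
  let f : FreeGroup (ι ⊕ S) →* K := FreeGroup.lift (Sum.elim (fun i => μ (.of i)) fun s => μ s)
  let r : FreeGroup (ι ⊕ S) →* FreeGroup ι := FreeGroup.lift (Sum.elim (fun i => .of i) 1)
  have hf : Function.Surjective f := fun x => by
    obtain ⟨e, rfl⟩ := hμ x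
    have : f.comp (FreeGroup.map Sum.inl) = μ := FreeGroup.ext_hom _ _ fun i => by simp [f]
    exact ⟨FreeGroup.map Sum.inl e, DFunLike.congr_fun this e⟩
  have hfr : (q.comp μ).comp r = q.comp f := by
    refine FreeGroup.ext_hom _ _ fun i => ?_
    rcases i with i | s
    · simp [f, r]
    · have : (s : FreeGroup ι) ∈ (q.comp μ).ker := hS ▸ subset_normalClosure s.2
      simpa [f, r, eq_comm] using this
  let W := r.ker
  let T := (p.comp f).ker
  have hfT : ∀ t ∈ T, f t ∈ p.ker := fun t ht => ht
  have hfW : ∀ w ∈ W, f w ∈ q.ker := fun w hw => by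
    have := DFunLike.congr_fun hfr w
    simp only [MonoidHom.comp_apply, MonoidHom.mem_ker.1 hw, map_one] at this
    exact this.symm
  have hWq : ∀ b ∈ q.ker, ∃ w ∈ W, f w = b := by
    have hn : (W.map f).Normal := Normal.map inferInstance f hf
    have hle : normalClosure S ≤ (W.map f).comap μ := normalClosure_le_normal fun s hs =>
      ⟨.of (Sum.inr ⟨s, hs⟩), by simp [W, r, MonoidHom.mem_ker], by simp [f]⟩
    intro b hb
    obtain ⟨e, rfl⟩ := hμ b
    exact hle (hS ▸ hb : e ∈ normalClosure S)
  let D : Subgroup (FreeGroup (ι ⊕ S)) := ⁅T, T⁆ ⊔ ⁅T, W⁆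
  have hDT : D ≤ T := sup_le (commutator_le_left _ _) (commutator_le_left _ _)
  have hD : ∀ d ∈ D, d ∈ W → f d = 1 := by
    let θ : T →* T.map r := r.subgroupMap T
    obtain ⟨σ, hσ⟩ := exists_section_of_isFreeGroup (r.subgroupMap_surjective T)
    let g : T →* K := (f.comp T.subtype).comp (σ.comp θ)
    have hg : ∀ t : T, ∃ z ∈ p.ker ⊓ q.ker, f t = g t * z := by
      intro t
      refine ⟨f ((σ (θ t))⁻¹ * t : T), ⟨hfT _ (SetLike.coe_mem _), hfW _ ?_⟩, ?_⟩
      · have := congrArg Subtype.val (hσ (θ t))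
        simp only [θ, MonoidHom.subgroupMap_apply_coe] at this
        simp [W, MonoidHom.mem_ker, θ, this]
      · simp [g]
    have hgp : ∀ t : T, g t ∈ p.ker := fun t => hfT _ (SetLike.coe_mem _)
    have hle : D ≤ (MonoidHom.eqLocus (f.comp T.subtype) g).map T.subtype := by
      refine sup_le (commutator_le.2 fun t ht t' ht' => ?_) (commutator_le.2 fun t ht w hw => ?_)
      · refine ⟨⁅(⟨t, ht⟩ : T), ⟨t', ht'⟩⁆, ?_, rfl⟩
        obtain ⟨z, hz, htz⟩ := hg ⟨t, ht⟩
        obtain ⟨z', hz', htz'⟩ := hg ⟨t', ht'⟩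
        have h1 := hcomm _ (hgp ⟨t, ht⟩) _ hz'.2
        have h2 := hcomm _ (hgp ⟨t', ht'⟩) _ hz.2
        have h3 := hcomm _ hz.1 _ hz'.2
        change f ⁅t, t'⁆ = g ⁅(⟨t, ht⟩ : T), ⟨t', ht'⟩⁆
        change f t = _ at htz
        change f t' = _ at htz'
        rw [map_commutatorElement, map_commutatorElement, htz, htz']
        exact commutatorElement_mul_mul_of_commute h1 h2 h3
      · have htw : ⁅t, w⁆ ∈ W := commutator_le_right T W (commutator_mem_commutator ht hw)
        have htT : ⁅t, w⁆ ∈ T := commutator_le_left T W (commutator_mem_commutator ht hw)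
        refine ⟨⟨_, htT⟩, ?_, rfl⟩
        have hθ : θ ⟨_, htT⟩ = 1 := Subtype.ext (MonoidHom.mem_ker.1 htw)
        have hft : f ⁅t, w⁆ = 1 := by
          rw [map_commutatorElement, commutatorElement_eq_one_iff_commute]
          exact hcomm _ (hfT t ht) _ (hfW w hw)
        change f ⁅t, w⁆ = g _
        simp [g, hθ, hft]
    intro d hdD hdW
    obtain ⟨t, ht, rfl⟩ := hle hdD
    have hθ : θ t = 1 := Subtype.ext (MonoidHom.mem_ker.1 hdW)
    have : f t = g t := ht
    simpa [g, hθ] using this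
  have hcommD : commutator (FreeGroup (ι ⊕ S)) ≤ T ⊔ W := by
    intro x hx
    have hfx : f x ∈ commutator K := by
      have := mem_map_of_mem f hx
      rw [_root_.commutator_def, map_commutator] at this
      exact commutator_mono le_top le_top this
    obtain ⟨a, ha, b, hb, hab⟩ := mem_sup_of_normal_right.1 (hab hfx)
    obtain ⟨w, hw, rfl⟩ := hWq b hb
    refine mem_sup_of_normal_right.2 ⟨x * w⁻¹, ?_, w, hw, by simp⟩
    have : f (x * w⁻¹) = a := by rw [map_mul, ← hab, map_inv, mul_inv_cancel_right]
    exact show p (f (x * w⁻¹)) = 1 from this ▸ ha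
  have hfgn : (T ⊓ W).map (QuotientGroup.mk' D) |>.IsFinitelyNormallyGenerated := by
    have hs := QuotientGroup.mk'_surjective D
    have : (T.map (QuotientGroup.mk' D)).Normal := Normal.map inferInstance _ hs
    have : ((T ⊓ W).map (QuotientGroup.mk' D)).Normal := Normal.map inferInstance _ hs
    have hTD : ∀ x ∈ T ⊔ W, ∀ t ∈ T,
        Commute (QuotientGroup.mk' D x) (QuotientGroup.mk' D t) := by
      intro x hx t ht
      obtain ⟨s, hs, w, hw, rfl⟩ := mem_sup_of_normal_right.1 hx
      have key : ∀ y, ⁅t, y⁆ ∈ D →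
          Commute (QuotientGroup.mk' D t) (QuotientGroup.mk' D y) := fun y hy => by
        rw [← commutatorElement_eq_one_iff_commute, ← map_commutatorElement]
        exact (QuotientGroup.eq_one_iff _).2 hy
      rw [map_mul]
      exact ((key s (le_sup_left (a := ⁅T, T⁆) (commutator_mem_commutator ht hs))).mul_right
        (key w (le_sup_right (a := ⁅T, T⁆) (commutator_mem_commutator ht hw)))).symm
    refine isFinitelyNormallyGenerated_of_le (T := T.map (QuotientGroup.mk' D)) ?_ ?_
      ((ker_isFinitelyNormallyGenerated (f := p.comp f) (hp.comp hf)).map hs) (map_mono inf_le_left)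
    · rintro _ ⟨x, hx, rfl⟩ _ ⟨t, ht, rfl⟩
      exact hTD x (le_sup_left (a := T) hx) t ht
    · rintro c hc _ ⟨t, ht, rfl⟩
      rw [_root_.commutator_def, ← MonoidHom.range_eq_top.2 hs, MonoidHom.range_eq_map,
        ← map_commutator] at hc
      obtain ⟨x, hx, rfl⟩ := hc
      exact hTD x (hcommD hx) t ht
  obtain ⟨Y, hY, hYeq⟩ := hfgn
  obtain ⟨Z, hZ, hZfin, rfl⟩ := exists_finite_subset_image_eq (f := QuotientGroup.mk' D)
    (u := (T ⊓ W : Subgroup _)) hY (by rw [← coe_map, ← hYeq]; exact subset_normalClosure)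
  rw [← map_normalClosure _ _ (QuotientGroup.mk'_surjective D)] at hYeq
  have hZle : normalClosure Z ≤ T ⊓ W := normalClosure_le_normal hZ
  refine ⟨f '' Z, hZfin.image f, le_antisymm (normalClosure_le_normal ?_) ?_⟩
  · rintro _ ⟨z, hz, rfl⟩
    exact ⟨hfT z (hZ hz).1, hfW z (hZ hz).2⟩
  · rintro x ⟨hxp, hxq⟩
    obtain ⟨w, hw, rfl⟩ := hWq x hxq
    obtain ⟨y, hy, hyw⟩ : QuotientGroup.mk' D w ∈ (normalClosure Z).map (QuotientGroup.mk' D) :=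
      hYeq ▸ ⟨w, ⟨hxp, hw⟩, rfl⟩
    have hd : y⁻¹ * w ∈ D := QuotientGroup.eq.1 hyw
    have := hD _ hd (W.mul_mem (W.inv_mem (hZle hy).2) hw)
    rw [map_mul, map_inv, inv_mul_eq_one] at this
    rw [← this, ← map_normalClosure _ _ hf]
    exact ⟨y, hy, rfl⟩

/-- A finitely generated group is a quotient of a finitely presented group in which the
preimages of two given normal subgroups commute. -/
theorem exists_isFinitelyPresented_commuting [Group.FG K] [Group.IsFinitelyPresented G]
    [Group.IsFinitelyPresented H] {p : K →* G} {q : K →* H} (hp : Function.Surjective p)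
    (hq : Function.Surjective q) (hbot : p.ker ⊓ q.ker = ⊥) (hfg : p.ker.FG) :
    ∃ (E : Type) (_ : Group E) (π : E →* K), Group.IsFinitelyPresented E ∧
      Function.Surjective π ∧ ∀ a ∈ (p.comp π).ker, ∀ b ∈ (q.comp π).ker, Commute a b := by
  obtain ⟨ι, _, π₀, hπ₀⟩ := Group.fg_iff_exists_freeGroup_hom_surjective_finite.1 ‹Group.FG K›
  obtain ⟨S, hSfin, hS⟩ := ker_isFinitelyNormallyGenerated (f := p.comp π₀) (hp.comp hπ₀)
  obtain ⟨R, hRfin, hR⟩ := ker_isFinitelyNormallyGenerated (f := q.comp π₀) (hq.comp hπ₀)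
  obtain ⟨X, hX, hXfin⟩ :=
    Monoid.fg_iff.1 (inferInstance : Monoid.FG (FreeGroup ι))
  obtain ⟨A₀, hA₀, hA₀fin⟩ := (Subgroup.fg_iff _).1 hfg
  obtain ⟨A, -, hAfin, rfl⟩ := exists_finite_subset_image_eq (f := π₀) (u := Set.univ) hA₀fin
    (by simp [hπ₀.range_eq])
  rw [← MonoidHom.map_closure] at hA₀
  have hAp : ∀ a ∈ closure A, a ∈ (p.comp π₀).ker := fun a ha =>
    (hA₀ ▸ mem_map_of_mem π₀ ha : π₀ a ∈ p.ker)
  have hw : ∀ e, ∃ w, e ∈ (p.comp π₀).ker → w ∈ closure A ∧ π₀ w = π₀ e := by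
    intro e
    by_cases he : e ∈ (p.comp π₀).ker
    · obtain ⟨w, hw, hwe⟩ : π₀ e ∈ (closure A).map π₀ := hA₀ ▸ he
      exact ⟨w, fun _ => ⟨hw, hwe⟩⟩
    · exact ⟨1, fun h => absurd h he⟩
  choose w hw using hw
  have hconj : ∀ x, ∀ a ∈ A, x * a * x⁻¹ ∈ (p.comp π₀).ker := fun x a ha =>
    (inferInstance : (p.comp π₀).ker.Normal).conj_mem _ (hAp a (subset_closure ha)) x
  let Q : Set (FreeGroup ι) := (fun s => s⁻¹ * w s) '' S ∪
    Set.image2 (fun x a => (x * a * x⁻¹)⁻¹ * w (x * a * x⁻¹)) X A ∪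
    Set.image2 (fun r a => ⁅r, a⁆) R A
  have hSp : ∀ s ∈ S, s ∈ (p.comp π₀).ker := fun s hs => hS ▸ subset_normalClosure hs
  have hRq : ∀ r ∈ R, r ∈ (q.comp π₀).ker := fun r hr => hR ▸ subset_normalClosure hr
  have hQ : normalClosure Q ≤ π₀.ker := by
    refine normalClosure_le_normal ?_
    rintro _ ((⟨s, hs, rfl⟩ | ⟨x, -, a, ha, rfl⟩) | ⟨r, hr, a, ha, rfl⟩)
    · simp [MonoidHom.mem_ker, (hw s (hSp s hs)).2]
    · have := (hw _ (hconj x a ha)).2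
      rw [SetLike.mem_coe, MonoidHom.mem_ker, map_mul, this, map_inv, inv_mul_cancel]
    · rw [SetLike.mem_coe, MonoidHom.mem_ker, map_commutatorElement,
        commutatorElement_eq_one_iff_commute]
      exact (commute_of_inf_eq_bot hbot (hAp a (subset_closure ha)) (hRq r hr)).symm
  let μ := QuotientGroup.mk' (normalClosure Q)
  have hμ : Function.Surjective μ := QuotientGroup.mk'_surjective _
  have hμQ : ∀ {x y}, x⁻¹ * y ∈ Q → μ x = μ y := fun h =>
    QuotientGroup.eq.2 (subset_normalClosure h)
  let π : FreeGroup ι ⧸ normalClosure Q →* K := QuotientGroup.lift _ π₀ hQ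
  have hπμ : ∀ e, π (μ e) = π₀ e := fun e => rfl
  let C := (closure A).map μ
  have hC : C = closure (μ '' A) := MonoidHom.map_closure _ _
  have hCn : C.Normal := by
    refine ⟨fun c hc g => ?_⟩
    obtain ⟨e, rfl⟩ := hμ g
    induction e using Submonoid.dense_induction X hX generalizing c with
    | mem x hx =>
      have : C ≤ C.comap (MulAut.conj (μ x)).toMonoidHom := by
        conv_lhs => rw [hC]
        rw [closure_le]
        rintro _ ⟨a, ha, rfl⟩
        have := hμQ (Or.inl (Or.inr ⟨x, hx, a, ha, rfl⟩))
        exact ⟨_, (hw _ (hconj x a ha)).1, by simp [← this]⟩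
      exact this hc
    | one => simpa using hc
    | mul x y hx hy =>
      simpa [mul_assoc] using hx _ (hy _ hc)
  refine ⟨FreeGroup ι ⧸ normalClosure Q, inferInstance, π, .quotient _ ⟨Q, ?_, rfl⟩,
    fun k => ?_, ?_⟩
  · exact ((hSfin.image _).union (hXfin.image2 _ hAfin)).union (hRfin.image2 _ hAfin)
  · obtain ⟨e, rfl⟩ := hπ₀ k
    exact ⟨μ e, rfl⟩
  · have hpC : (p.comp π).ker ≤ C := by
      intro g hg
      obtain ⟨e, rfl⟩ := hμ g
      have hle : normalClosure S ≤ C.comap μ := normalClosure_le_normal fun s hs =>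
        ⟨w s, (hw s (hSp s hs)).1, (hμQ (Or.inl (Or.inl ⟨s, hs, rfl⟩))).symm⟩
      exact hle (hS ▸ hg : e ∈ normalClosure S)
    have hcent : normalClosure R ≤ (centralizer (C : Set _)).comap μ := by
      refine normalClosure_le_normal fun r hr => ?_
      rw [hC, centralizer_closure]
      change μ r ∈ centralizer _
      rw [mem_centralizer_iff]
      rintro _ ⟨a, ha, rfl⟩
      refine (commutatorElement_eq_one_iff_commute.1 ?_ : Commute (μ r) (μ a)).symm.eq
      rw [← map_commutatorElement]
      exact (QuotientGroup.eq_one_iff _).2 (subset_normalClosure (Or.inr ⟨r, hr, a, ha, rfl⟩))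
    intro a ha b hb
    obtain ⟨e, rfl⟩ := hμ b
    exact mem_centralizer_iff.1 (hcent (hR ▸ hb : e ∈ normalClosure R)) _ (hpC ha)

/-- A group with two normal subgroups that intersect trivially, both with finitely presented
quotient, one of them finitely generated, and whose product has abelian quotient, is finitely
presented. -/
theorem isFinitelyPresented_of_subdirect [Group.IsFinitelyPresented G]
    [Group.IsFinitelyPresented H] {p : K →* G} {q : K →* H} (hp : Function.Surjective p)
    (hq : Function.Surjective q) (hbot : p.ker ⊓ q.ker = ⊥) (hfg : p.ker.FG)
    (hab : commutator K ≤ p.ker ⊔ q.ker) : Group.IsFinitelyPresented K := by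
  have := fg_of_isFinitelyPresented (G := G)
  have := fg_of_isFinitelyPresented (G := H)
  have := fg_of_subdirect hp hq hbot hab
  obtain ⟨E, _, π, _, hπ, hcomm⟩ := exists_isFinitelyPresented_commuting hp hq hbot hfg
  have := fg_of_isFinitelyPresented (G := E)
  refine .of_surjective π hπ ?_
  have hker : π.ker = (p.comp π).ker ⊓ (q.comp π).ker := by
    rw [← MonoidHom.comap_ker, ← MonoidHom.comap_ker, ← comap_inf, hbot, MonoidHom.comap_bot]
  rw [hker]
  refine inf_isFinitelyNormallyGenerated (hp.comp hπ) (hq.comp hπ) hcomm ?_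
  rw [← MonoidHom.comap_ker, ← MonoidHom.comap_ker, comap_sup_eq _ _ _ hπ,
    ← map_le_iff_le_comap, _root_.commutator_def, map_commutator]
  exact (commutator_mono le_top le_top).trans hab

end Presentations

section ExtendOne

variable {ι : Type} [DecidableEq ι] {G : ι → Type} [∀ i, Group (G i)]

/-- Extension by `1` of a family defined away from one index. -/
def extendOne (G : ι → Type) [∀ i, Group (G i)] (i₀ : ι) :
    (∀ i : {i // i ≠ i₀}, G i) →* ∀ i, G i where
  toFun z i := if h : i ≠ i₀ then z ⟨i, h⟩ else 1
  map_one' := by ext i; simp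
  map_mul' z z' := by
    ext i
    by_cases h : i = i₀ <;> simp [h]

theorem extendOne_self (i₀ : ι) (z : ∀ i : {i // i ≠ i₀}, G i) : extendOne G i₀ z i₀ = 1 := by
  simp [extendOne]

theorem extendOne_of_ne {i₀ i : ι} (z : ∀ i : {i // i ≠ i₀}, G i) (h : i ≠ i₀) :
    extendOne G i₀ z i = z ⟨i, h⟩ := by
  simp [extendOne, h]

end ExtendOne

section CoabelianKernel

variable {ι L : Type} [Fintype ι] [CommGroup L] {G : ι → Type} [∀ i, Group (G i)]

/-- The product of a finite family of homomorphisms to a commutative group, as a homomorphism on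
the product of their domains. -/
def prodHom (φ : ∀ i, G i →* L) : (∀ i, G i) →* L := ∏ i, (φ i).comp (Pi.evalMonoidHom G i)

theorem prodHom_apply (φ : ∀ i, G i →* L) (g : ∀ i, G i) : prodHom φ g = ∏ i, φ i (g i) := by
  simp [prodHom]

/-- The projection of the kernel of `prodHom φ` to a factor. -/
def kerEval (φ : ∀ i, G i →* L) (i₀ : ι) : (prodHom φ).ker →* G i₀ :=
  (Pi.evalMonoidHom G i₀).comp (Subgroup.subtype _)

/-- The projection of the kernel of `prodHom φ` to the product of all factors but one. -/
def kerRestrict (φ : ∀ i, G i →* L) (i₀ : ι) : (prodHom φ).ker →* ∀ i : {i // i ≠ i₀}, G i :=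
  (MonoidHom.pi fun i : {i // i ≠ i₀} => Pi.evalMonoidHom G i).comp (Subgroup.subtype _)

theorem mem_ker_kerRestrict {φ : ∀ i, G i →* L} {i₀ : ι} {k : (prodHom φ).ker} :
    k ∈ (kerRestrict φ i₀).ker ↔ ∀ i, i ≠ i₀ → k.1 i = 1 := by
  rw [MonoidHom.mem_ker, funext_iff, Subtype.forall]
  rfl

variable [DecidableEq ι]

theorem prodHom_mulSingle (φ : ∀ i, G i →* L) (i : ι) (x : G i) :
    prodHom φ (Pi.mulSingle i x) = φ i x := by
  rw [prodHom_apply, Fintype.prod_eq_single i fun j hj => by simp [Pi.mulSingle_eq_of_ne hj],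
    Pi.mulSingle_eq_same]

theorem prodHom_extendOne (φ : ∀ i, G i →* L) (i₀ : ι) (z : ∀ i : {i // i ≠ i₀}, G i) :
    prodHom φ (extendOne G i₀ z) = prodHom (fun i : {i // i ≠ i₀} => φ i) z := by
  rw [prodHom_apply, prodHom_apply,
    ← Fintype.prod_subtype_mul_prod_subtype (fun i => i ≠ i₀)]
  rw [Fintype.prod_eq_one (fun i : {i // ¬ i ≠ i₀} => φ i (extendOne G i₀ z i)), mul_one]
  · exact Finset.prod_congr rfl fun i _ => by rw [extendOne_of_ne z i.2]
  · rintro ⟨i, hi⟩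
    obtain rfl := not_ne_iff.1 hi
    simp [extendOne_self]

theorem kerEval_surjective {φ : ∀ i, G i →* L} (hφ : ∀ i, Function.Surjective (φ i)) {i₀ i₁ : ι}
    (h : i₁ ≠ i₀) : Function.Surjective (kerEval φ i₀) := fun x => by
  obtain ⟨y, hy⟩ := hφ i₁ (φ i₀ x)⁻¹
  refine ⟨⟨Pi.mulSingle i₀ x * Pi.mulSingle i₁ y, ?_⟩, ?_⟩
  · rw [MonoidHom.mem_ker, map_mul, prodHom_mulSingle, prodHom_mulSingle, hy, mul_inv_cancel]
  · simp [kerEval, Pi.mulSingle_eq_of_ne h.symm]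

theorem kerRestrict_surjective {φ : ∀ i, G i →* L} {i₀ : ι} (hφ : Function.Surjective (φ i₀)) :
    Function.Surjective (kerRestrict φ i₀) := fun z => by
  obtain ⟨y, hy⟩ := hφ (prodHom φ (extendOne G i₀ z))⁻¹
  refine ⟨⟨extendOne G i₀ z * Pi.mulSingle i₀ y, ?_⟩, ?_⟩
  · rw [MonoidHom.mem_ker, map_mul, prodHom_mulSingle, hy, mul_inv_cancel]
  · ext i
    change extendOne G i₀ z i * Pi.mulSingle (M := G) i₀ y i = z i
    rw [extendOne_of_ne z i.2, Pi.mulSingle_eq_of_ne i.2, mul_one]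

theorem kerEval_inf_kerRestrict (φ : ∀ i, G i →* L) (i₀ : ι) :
    (kerEval φ i₀).ker ⊓ (kerRestrict φ i₀).ker = ⊥ := by
  refine eq_bot_iff.2 fun k hk => Subtype.ext (funext fun i => ?_)
  by_cases h : i = i₀
  · subst h
    exact hk.1
  · exact mem_ker_kerRestrict.1 hk.2 i h

theorem commutator_le_kerEval_sup_kerRestrict (φ : ∀ i, G i →* L) (i₀ : ι) :
    commutator (prodHom φ).ker ≤ (kerEval φ i₀).ker ⊔ (kerRestrict φ i₀).ker := by
  rw [_root_.commutator_def]
  refine commutator_le.2 fun k _ k' _ => mem_sup_of_normal_right.2 ?_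
  let m : (prodHom φ).ker := ⟨Pi.mulSingle i₀ ⁅k.1 i₀, k'.1 i₀⁆, by
    rw [MonoidHom.mem_ker, prodHom_mulSingle, map_commutatorElement,
      commutatorElement_eq_one_iff_commute]
    exact Commute.all _ _⟩
  refine ⟨⁅k, k'⁆ * m⁻¹, ?_, m, ?_, inv_mul_cancel_right _ _⟩
  · have hm : kerEval φ i₀ m = ⁅kerEval φ i₀ k, kerEval φ i₀ k'⁆ := Pi.mulSingle_eq_same _ _
    rw [MonoidHom.mem_ker, map_mul, map_inv, hm, map_commutatorElement, mul_inv_cancel]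
  · exact mem_ker_kerRestrict.2 fun i hi => Pi.mulSingle_eq_of_ne hi _

/-- For a family of surjections `φ` from finitely generated groups to a commutative group, the
kernel of `prodHom φ` is finitely generated as soon as there are at least two factors. -/
theorem fg_ker_prodHom [∀ i, Group.IsFinitelyPresented (G i)] {φ : ∀ i, G i →* L}
    (hφ : ∀ i, Function.Surjective (φ i)) {i₀ i₁ : ι} (h : i₁ ≠ i₀) :
    Group.FG (prodHom φ).ker := by
  have := fg_of_isFinitelyPresented (G := G i₀)
  have := isFinitelyPresented_pi {i // i ≠ i₀} fun i => G i
  have := fg_of_isFinitelyPresented (G := ∀ i : {i // i ≠ i₀}, G i)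
  exact fg_of_subdirect (kerEval_surjective hφ h) (kerRestrict_surjective (hφ i₀))
    (kerEval_inf_kerRestrict φ i₀) (commutator_le_kerEval_sup_kerRestrict φ i₀)

/-- The elements of the kernel of `prodHom φ` with trivial coordinate at a given index form a
finitely generated group as soon as there are at least three factors. -/
theorem fg_ker_kerEval [∀ i, Group.IsFinitelyPresented (G i)] {φ : ∀ i, G i →* L}
    (hφ : ∀ i, Function.Surjective (φ i)) {i₀ i₁ i₂ : ι} (h₁ : i₁ ≠ i₀) (h₂ : i₂ ≠ i₀)
    (h : i₂ ≠ i₁) : (kerEval φ i₀).ker.FG := by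
  have := fg_ker_prodHom (φ := fun i : {i // i ≠ i₀} => φ i) (fun i => hφ i)
    (i₀ := ⟨i₁, h₁⟩) (i₁ := ⟨i₂, h₂⟩) fun e => h (congrArg Subtype.val e)
  let e : (prodHom fun i : {i // i ≠ i₀} => φ i).ker →* (prodHom φ).ker :=
    ((extendOne G i₀).comp (Subgroup.subtype _)).codRestrict _ fun z =>
      (prodHom_extendOne φ i₀ z.1).trans z.2
  have he : e.range = (kerEval φ i₀).ker := by
    refine le_antisymm ?_ fun k hk => ?_
    · rintro _ ⟨z, rfl⟩
      exact extendOne_self i₀ z.1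
    · have hek : extendOne G i₀ (kerRestrict φ i₀ k) = k := by
        funext i
        by_cases h : i = i₀
        · subst h
          exact (extendOne_self i _).trans hk.symm
        · exact extendOne_of_ne _ h
      refine ⟨⟨kerRestrict φ i₀ k, ?_⟩, Subtype.ext hek⟩
      rw [MonoidHom.mem_ker, ← prodHom_extendOne, hek]
      exact k.2
  rw [← he, ← Group.fg_iff_subgroup_fg]
  exact Group.fg_range e

/-- For a family of surjections `φ` from finitely presented groups to a commutative group, the
kernel of `prodHom φ` is finitely presented as soon as there are at least three factors. -/
theorem isFinitelyPresented_ker_prodHom [∀ i, Group.IsFinitelyPresented (G i)]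
    {φ : ∀ i, G i →* L} (hφ : ∀ i, Function.Surjective (φ i)) {i₀ i₁ i₂ : ι} (h₁ : i₁ ≠ i₀)
    (h₂ : i₂ ≠ i₀) (h : i₂ ≠ i₁) : Group.IsFinitelyPresented (prodHom φ).ker := by
  have := isFinitelyPresented_pi {i // i ≠ i₀} fun i => G i
  exact isFinitelyPresented_of_subdirect (kerEval_surjective hφ h₁)
    (kerRestrict_surjective (hφ i₀)) (kerEval_inf_kerRestrict φ i₀) (fg_ker_kerEval hφ h₁ h₂ h)
    (commutator_le_kerEval_sup_kerRestrict φ i₀)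

end CoabelianKernel

theorem stmt_0
    (n : ℕ) (hn : 3 ≤ n)
    (A : Fin n → Type) [∀ j, CommGroup (A j)] [∀ j, Nontrivial (A j)]
    [∀ j, Module.Free ℤ (Additive (A j))] [∀ j, Module.Finite ℤ (Additive (A j))]
    (G : Fin (2 * n) → Type) [∀ i, Group (G i)]
    (φ : ∀ i, G i →* (∀ j, A j)) (hφ : ∀ i, Function.Surjective (φ i))
    (s : ∀ (j : Fin n) (i : Fin (2 * n)), A j →* G i)
    (hs : ∀ j i a, φ i (s j i a) j = a)
    (Φ : (∀ i, G i) →* (∀ j, A j)) (hΦ : ∀ g, Φ g = ∏ i, φ i (g i))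
    (hFP : ∀ i, ∃ (k : ℕ) (R : Finset (FreeGroup (Fin k))) (π : FreeGroup (Fin k) →* G i),
      Function.Surjective π ∧ MonoidHom.ker π = Subgroup.normalClosure ↑R) :
    ∃ (k : ℕ) (R : Finset (FreeGroup (Fin k))) (π : FreeGroup (Fin k) →* ↥(MonoidHom.ker Φ)),
      Function.Surjective π ∧ MonoidHom.ker π = Subgroup.normalClosure ↑R := by
  have (i : Fin (2 * n)) : Group.IsFinitelyPresented (G i) := by
    obtain ⟨k, R, π, hπ, hR⟩ := hFP i
    exact ⟨k, π, hπ, R, R.finite_toSet, hR.symm⟩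
  obtain rfl : Φ = prodHom φ := MonoidHom.ext fun g => (hΦ g).trans (prodHom_apply φ g).symm
  have : Group.IsFinitelyPresented (prodHom φ).ker :=
    isFinitelyPresented_ker_prodHom hφ (i₀ := ⟨0, by lia⟩) (i₁ := ⟨1, by lia⟩)
      (i₂ := ⟨2, by lia⟩) (by simp) (by simp) (by simp)
  obtain ⟨k, π, hπ, R, hR, hker⟩ := this
  exact ⟨k, hR.toFinset, π, hπ, by rw [hR.coe_toFinset, hker]⟩

end SB
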